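/- Let D, D' be self-adjoint operators on a Hilbert space H with D' - D bounded, and suppose D·(1+D^2)^{-1} is compact and (1+D^2)^{-1} is compact. Then the difference of bounded transforms D(1+D^2)^{-1/2} - D'(1+D'^2)^{-1/2} is a compact operator. -/

import Mathlib

variable {H : Type*} [NormedAddCommGroup H] [InnerProductSpace ℂ H] [CompleteSpace H]

/-- `R` is the bounded operator `(1 + D^2)⁻¹`. -/
def IsResolventOfOnePlusSq (D : H →ₗ.[ℂ] H) (R : H →L[ℂ] H) : Prop :=
  ∀ y : H, ∃ (h1 : R y ∈ D.domain) (h2 : D ⟨R y, h1⟩ ∈ D.domain),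
    R y + D ⟨D ⟨R y, h1⟩, h2⟩ = y

/-- `S` is the bounded operator `D · (1 + D^2)⁻¹`, where `R = (1 + D^2)⁻¹`. -/
def IsDTimesResolvent (D : H →ₗ.[ℂ] H) (R S : H →L[ℂ] H) : Prop :=
  ∀ y : H, ∃ h1 : R y ∈ D.domain, S y = D ⟨R y, h1⟩

/-- `F` is the bounded transform `D (1 + D²)^{-1/2}` of `D`: here `Q` is the positive
square root of the resolvent `R = (1+D²)⁻¹` and `F = D ∘ Q`. -/
def IsBoundedTransform (D : H →ₗ.[ℂ] H) (R Q F : H →L[ℂ] H) : Prop :=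
  Q.IsPositive ∧ Q ∘L Q = R ∧ ∀ y : H, ∃ h : Q y ∈ D.domain, F y = D ⟨Q y, h⟩


theorem sylv_bound (T C Q Q' k h : H →L[ℂ] H)
    (hQ' : Q'.IsPositive) (hsyl : T * Q + Q' * T = Q' * C * Q)
    (hk : IsSelfAdjoint k) (hkQ : k * Q = Q * k) (hkh : k = Q * h)
    (hkc : IsCompactOperator (⇑k)) (c δ : ℝ) (hδ : 0 ≤ δ)
    (h1 : ∀ z, ‖k (Q z)‖ ^ 2 ≤ δ * RCLike.re (inner ℂ (Q z) z))
    (h2 : ∀ z, ‖Q z‖ ^ 2 ≤ c * RCLike.re (inner ℂ (Q z) z)) (hc : 0 ≤ c) :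
    ‖T * k‖ ≤ ‖C‖ * Real.sqrt (δ * c) := by
  set Y := T * k with hY
  rcases eq_or_ne Y 0 with h0 | h0
  · rw [h0, norm_zero]; positivity
  have hm : 0 < ‖Y‖ := norm_pos_iff.2 h0
  have hMn : ‖star Y * Y‖ = ‖Y‖ * ‖Y‖ := CStarRing.norm_star_mul_self
  have hMne : star Y * Y ≠ 0 := by
    rw [← norm_pos_iff, hMn]; positivity
  have : Nontrivial (H →L[ℂ] H) := ⟨⟨_, _, h0⟩⟩
  have hspec : ‖star Y * Y‖ ∈ spectrum ℝ (star Y * Y) :=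
    CStarAlgebra.norm_mem_spectrum_of_nonneg (star_mul_self_nonneg Y)
  have hspec' : ((‖star Y * Y‖ : ℝ) : ℂ) ∈ spectrum ℂ (star Y * Y) := by
    simpa using spectrum.algebraMap_mem ℂ hspec
  have hMc : IsCompactOperator (⇑(star Y * Y)) := by
    have := hkc.clm_comp (star Y * T)
    simpa [hY, mul_assoc, Function.comp_def] using this
  have hev := (hMc.hasEigenvalue_iff_mem_spectrum
    (by exact_mod_cast (norm_pos_iff.2 hMne).ne')).2 hspec'
  obtain ⟨v, hv⟩ := hev.exists_hasEigenvector
  have hv0 : v ≠ 0 := hv.2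
  have hMv : (star Y) (Y v) = ((‖Y‖ * ‖Y‖ : ℝ) : ℂ) • v := by
    have := hv.apply_eq_smul
    rw [hMn] at this
    exact this
  set m := ‖Y‖ with hmdef
  have hmC : ((m * m : ℝ) : ℂ) ≠ 0 := by exact_mod_cast (mul_pos hm hm).ne'
  obtain ⟨z, hz⟩ : ∃ z, v = Q z := by
    refine ⟨(((m * m : ℝ) : ℂ))⁻¹ • h (star T (Y v)), ?_⟩
    have e : star Y = Q * h * star T := by
      rw [hY, star_mul, hk.star_eq, ← hkh]
    rw [map_smul]
    rw [e] at hMv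
    simp only [mul_apply_eq_comp] at hMv
    rw [hMv, smul_smul, inv_mul_cancel₀ hmC, one_smul]
  have hYv : Y v = Q' (C (k v) - Y z) := by
    have e := congrArg (fun A => A (k z)) hsyl
    simp only [mul_apply_eq_comp, add_apply] at e
    have e2 : Q (k z) = k v := by
      rw [hz]; exact (congrArg (fun A => A z) hkQ).symm
    rw [e2] at e
    rw [map_sub, eq_sub_iff_add_eq]
    exact e
  set a := RCLike.re (inner ℂ v z) with ha
  have hpos := hQ'.re_inner_nonneg_left (C (k v) - Y z)
  rw [← hYv, inner_sub_right, map_sub] at hpos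
  have e3 : RCLike.re (inner ℂ (Y v) (Y z)) = m * m * a := by
    rw [← ContinuousLinearMap.adjoint_inner_left, ← ContinuousLinearMap.star_eq_adjoint, hMv,
      inner_smul_left, Complex.conj_ofReal]
    exact RCLike.re_ofReal_mul _ _
  have h1' := h1 z
  have h2' := h2 z
  rw [← hz, ← ha] at h1' h2'
  have ha0 : 0 < a := by
    have : 0 < ‖v‖ ^ 2 := by have := norm_pos_iff.2 hv0; positivity
    by_contra hcon
    push Not at hcon
    nlinarith [h2', mul_nonneg hc (neg_nonneg.2 hcon)]
  have e4 : RCLike.re (inner ℂ (Y v) (C (k v))) ≤ (m * ‖v‖) * (‖C‖ * ‖k v‖) :=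
    (RCLike.re_le_norm _).trans ((norm_inner_le_norm _ _).trans
      (mul_le_mul (Y.le_opNorm v) (C.le_opNorm _) (norm_nonneg _) (by positivity)))
  have e5 : ‖v‖ * ‖k v‖ ≤ Real.sqrt (δ * c) * a := by
    have : Real.sqrt (δ * c) * a = Real.sqrt ((δ * a) * (c * a)) := by
      rw [show (δ * a) * (c * a) = (δ * c) * (a * a) by ring, Real.sqrt_mul (mul_nonneg hδ hc),
        Real.sqrt_mul_self ha0.le]
    rw [this]
    apply Real.le_sqrt_of_sq_le
    rw [mul_pow, mul_comm]
    exact mul_le_mul h1' h2' (by positivity) (by positivity)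
  have e6 : m * m * a ≤ m * ‖C‖ * (Real.sqrt (δ * c) * a) := by
    calc m * m * a ≤ (m * ‖v‖) * (‖C‖ * ‖k v‖) := by linarith
      _ = m * ‖C‖ * (‖v‖ * ‖k v‖) := by ring
      _ ≤ _ := by gcongr
  have e7 : (m * a) * m ≤ (m * a) * (‖C‖ * Real.sqrt (δ * c)) := by linarith
  exact le_of_mul_le_mul_left e7 (by positivity)

theorem real_inner_smul_left_aux (r : ℝ) (x y : H) :
    RCLike.re (inner ℂ (r • x) y) = r * RCLike.re (inner ℂ x y) := by
  rw [← Complex.coe_smul, inner_smul_left, Complex.conj_ofReal]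
  exact RCLike.re_ofReal_mul _ _

noncomputable def cutH (δ x : ℝ) : ℝ := ((max x δ) ^ 2)⁻¹

theorem cutH_cont {δ : ℝ} (hδ : 0 < δ) : Continuous (cutH δ) := by
  unfold cutH
  refine Continuous.inv₀ (by fun_prop) (fun x => ?_)
  have : 0 < max x δ := lt_max_of_lt_right hδ
  positivity

theorem cut_nonneg (δ x : ℝ) : 0 ≤ x ^ 2 * cutH δ x := by
  unfold cutH; positivity

theorem cut_le_one {δ x : ℝ} (hδ : 0 < δ) (hx : 0 ≤ x) : x ^ 2 * cutH δ x ≤ 1 := by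
  unfold cutH
  have h1 : 0 < max x δ := lt_max_of_lt_right hδ
  rw [← div_eq_mul_inv, div_le_one (by positivity)]
  have := le_max_left x δ
  gcongr

theorem cut_mul_le {δ x : ℝ} (hδ : 0 < δ) (hx : 0 ≤ x) : (1 - x ^ 2 * cutH δ x) * x ≤ δ := by
  rcases le_total x δ with h | h
  · have := cut_nonneg δ x
    nlinarith
  · have : x ≠ 0 := by linarith [hδ.trans_le h] |> fun (h : 0 < x) => h.ne'
    unfold cutH
    rw [max_eq_left h, mul_inv_cancel₀ (by positivity)]
    linarith

theorem sylv_compact (T C Q Q' : H →L[ℂ] H) (hQ : Q.IsPositive)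
    (hQ' : Q'.IsPositive) (hsyl : T * Q + Q' * T = Q' * C * Q)
    (hdr : DenseRange (⇑Q)) (hcomp : IsCompactOperator (⇑(Q * Q))) :
    IsCompactOperator (⇑T) := by
  have hsa : IsSelfAdjoint Q := hQ.isSelfAdjoint
  have hQ0 : 0 ≤ Q := (ContinuousLinearMap.nonneg_iff_isPositive Q).2 hQ
  have hsp : ∀ x ∈ spectrum ℝ Q, 0 ≤ x := fun x hx => spectrum_nonneg_of_nonneg hQ0 hx
  have hsp2 : ∀ x ∈ spectrum ℝ Q, x ≤ ‖Q‖ := fun x hx =>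
    (le_abs_self x).trans (by
      have := norm_apply_le_norm_cfc (id : ℝ → ℝ) Q hx
      rwa [cfc_id ℝ Q] at this)
  have hQid : cfc (fun x : ℝ => x) Q = Q := cfc_id' ℝ Q
  have hpos : ∀ A : H →L[ℂ] H, 0 ≤ A → ∀ z, 0 ≤ RCLike.re (inner ℂ (A z) z) := fun A hA z =>
    ((ContinuousLinearMap.nonneg_iff_isPositive A).1 hA).re_inner_nonneg_left z
  set K : ℝ → (H →L[ℂ] H) := fun δ => cfc (fun x : ℝ => x ^ 2 * cutH δ x) Q with hK
  have hKmul : ∀ δ > 0, K δ = (Q * Q) * cfc (cutH δ) Q := by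
    intro δ hδ
    have := cutH_cont hδ
    rw [hK]
    simp only
    rw [cfc_mul (fun x : ℝ => x ^ 2) (cutH δ) Q (by fun_prop) (by fun_prop), cfc_pow_id Q 2, pow_two]
  have hKsub : ∀ δ > 0, 1 - K δ = cfc (fun x : ℝ => 1 - x ^ 2 * cutH δ x) Q := by
    intro δ hδ
    have := cutH_cont hδ
    rw [cfc_sub (fun _ : ℝ => (1:ℝ)) _ Q (by fun_prop) (by fun_prop), cfc_const_one ℝ Q]
  have hKQ : ∀ δ > 0, ‖(1 - K δ) * Q‖ ≤ δ := by
    intro δ hδ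
    have := cutH_cont hδ
    have e : (1 - K δ) * Q = cfc (fun x : ℝ => (1 - x ^ 2 * cutH δ x) * x) Q := by
      rw [cfc_mul _ (fun x : ℝ => x) Q (by fun_prop) (by fun_prop), hQid, hKsub δ hδ]
    rw [e]
    refine norm_cfc_le hδ.le (fun x hx => ?_)
    have hx0 := hsp x hx
    rw [Real.norm_of_nonneg (mul_nonneg (by linarith [cut_le_one hδ hx0]) hx0)]
    exact cut_mul_le hδ hx0
  have main : ∀ δ > 0, ∀ η > 0, ‖T * ((1 - K δ) * K η)‖ ≤ ‖C‖ * Real.sqrt (δ * ‖Q‖) := by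
    intro δ hδ η hη
    have c1 := cutH_cont hδ
    have c2 := cutH_cont hη
    have hk : (1 - K δ) * K η
        = cfc (fun x : ℝ => (1 - x ^ 2 * cutH δ x) * (x ^ 2 * cutH η x)) Q := by
      rw [hKsub δ hδ, hK]
      simp only
      rw [cfc_mul (fun x : ℝ => 1 - x ^ 2 * cutH δ x) (fun x : ℝ => x ^ 2 * cutH η x) Q
        (by fun_prop) (by fun_prop)]
    set k := (1 - K δ) * K η with hkdef
    have hksa : IsSelfAdjoint k := by rw [hk]; exact cfc_predicate _ Q
    have hkQ : k * Q = Q * k := by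
      rw [hk]; exact (Commute.cfc_real (Commute.refl Q) _)
    have hkh : k = Q * (Q * cfc (fun x : ℝ => (1 - x ^ 2 * cutH δ x) * cutH η x) Q) := by
      rw [← mul_assoc, ← pow_two, ← cfc_pow_id (R := ℝ) Q 2, hk,
        ← cfc_mul (fun x : ℝ => x ^ 2) _ Q (by fun_prop) (by fun_prop)]
      congr 1
      ext x
      ring
    refine sylv_bound T C Q Q' k _ hQ' hsyl hksa hkQ hkh ?_ ‖Q‖ δ hδ.le ?_ ?_ (norm_nonneg _)
    · rw [hkh, ← mul_assoc]
      exact hcomp.comp_clm _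
    · intro z
      have hnn : 0 ≤ δ • Q - Q * (k * (k * Q)) := by
        have e : δ • Q - Q * (k * (k * Q)) = cfc (fun x : ℝ => δ • x - x *
            (((1 - x ^ 2 * cutH δ x) * (x ^ 2 * cutH η x)) *
            (((1 - x ^ 2 * cutH δ x) * (x ^ 2 * cutH η x)) * x))) Q := by
          rw [cfc_sub _ _ Q (by fun_prop) (by fun_prop),
            cfc_smul δ (fun x : ℝ => x) Q (by fun_prop),
            cfc_mul _ _ Q (by fun_prop) (by fun_prop),
            cfc_mul _ (fun x : ℝ => ((1 - x ^ 2 * cutH δ x) * (x ^ 2 * cutH η x)) * x) Q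
              (by fun_prop) (by fun_prop),
            cfc_mul _ (fun x : ℝ => x) Q (by fun_prop) (by fun_prop), ← hk, hQid]
        rw [e]
        refine cfc_nonneg (fun x hx => ?_)
        have hx0 := hsp x hx
        have b1 := cut_le_one hδ hx0
        have b2 := cut_le_one hη hx0
        have b3 := cut_nonneg δ x
        have b4 := cut_nonneg η x
        have b5 := cut_mul_le hδ hx0
        rw [smul_eq_mul]
        generalize x ^ 2 * cutH δ x = p at *
        generalize x ^ 2 * cutH η x = q at *
        have d1 : (1 - p) * x * ((1 - p) * (q * q)) ≤ δ * 1 := by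
          have : (1 - p) * (q * q) ≤ 1 :=
            mul_le_one₀ (by linarith) (by positivity) (mul_le_one₀ b2 b4 b2)
          exact mul_le_mul b5 this (mul_nonneg (by linarith) (by positivity)) hδ.le
        nlinarith [mul_le_mul_of_nonneg_right d1 hx0]
      have := hpos _ hnn z
      simp only [sub_apply, smul_apply, mul_apply_eq_comp, inner_sub_left, map_sub] at this
      have e1 : inner ℂ (Q (k (k (Q z)))) z = inner ℂ (k (Q z)) (k (Q z)) := by
        rw [hQ.inner_left_eq_inner_right]
        exact hksa.isSymmetric _ _
      have e2 : RCLike.re (inner ℂ (δ • Q z) z) = δ * RCLike.re (inner ℂ (Q z) z) := by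
        rw [real_inner_smul_left_aux]
      rw [e1, e2, inner_self_eq_norm_sq] at this
      linarith
    · intro z
      have hnn : 0 ≤ ‖Q‖ • Q - Q * Q := by
        have e : ‖Q‖ • Q - Q * Q = cfc (fun x : ℝ => ‖Q‖ • x - x * x) Q := by
          rw [cfc_sub _ _ Q (by fun_prop) (by fun_prop),
            cfc_smul ‖Q‖ (fun x : ℝ => x) Q (by fun_prop),
            cfc_mul _ _ Q (by fun_prop) (by fun_prop), hQid]
        rw [e]
        refine cfc_nonneg (fun x hx => ?_)
        have hx0 := hsp x hx
        have := hsp2 x hx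
        rw [smul_eq_mul]
        nlinarith
      have := hpos _ hnn z
      simp only [sub_apply, smul_apply, mul_apply_eq_comp, inner_sub_left, map_sub] at this
      rw [hQ.inner_left_eq_inner_right (Q z), real_inner_smul_left_aux, inner_self_eq_norm_sq] at this
      linarith
  have main2 : ∀ δ > 0, ‖T * (1 - K δ)‖ ≤ ‖C‖ * Real.sqrt (δ * ‖Q‖) := by
    intro δ hδ
    refine ContinuousLinearMap.opNorm_le_bound _ (by positivity) (fun x => ?_)
    refine hdr.induction_on (p := fun x => ‖(T * (1 - K δ)) x‖ ≤ ‖C‖ * Real.sqrt (δ * ‖Q‖) * ‖x‖) x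
      (isClosed_le (by fun_prop) (by fun_prop)) (fun w => ?_)
    set Z := T * (1 - K δ) with hZ
    refine le_of_forall_pos_le_add (fun ε hε => ?_)
    obtain ⟨η, hη, hηε⟩ : ∃ η > 0, ‖Z‖ * (η * ‖w‖) ≤ ε := by
      refine ⟨ε / (‖Z‖ * ‖w‖ + 1), by positivity, ?_⟩
      rw [show ‖Z‖ * (ε / (‖Z‖ * ‖w‖ + 1) * ‖w‖) = ε * ((‖Z‖ * ‖w‖) / (‖Z‖ * ‖w‖ + 1)) by ring]
      refine mul_le_of_le_one_right hε.le ?_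
      rw [div_le_one (by positivity)]
      linarith
    have e : Z (Q w) = (T * ((1 - K δ) * K η)) (Q w) + Z (((1 - K η) * Q) w) := by
      simp [hZ]
      abel
    rw [e]
    refine (norm_add_le _ _).trans (add_le_add ?_ ?_)
    · exact (ContinuousLinearMap.le_opNorm _ _).trans (by gcongr; exact main δ hδ η hη)
    · refine le_trans ((Z.le_opNorm _).trans ?_) hηε
      gcongr
      exact (ContinuousLinearMap.le_opNorm _ _).trans (by gcongr; exact hKQ η hη)
  have htend : Filter.Tendsto (fun n : ℕ => T * K (1 / ((n : ℝ) + 1))) Filter.atTop (nhds T) := by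
    rw [tendsto_iff_norm_sub_tendsto_zero]
    have h0 : Filter.Tendsto (fun n : ℕ => ‖C‖ * Real.sqrt ((1 / ((n : ℝ) + 1)) * ‖Q‖))
        Filter.atTop (nhds 0) := by
      have := tendsto_one_div_add_atTop_nhds_zero_nat (𝕜 := ℝ)
      have h3 := ((Real.continuous_sqrt.tendsto _).comp (this.mul_const ‖Q‖)).const_mul ‖C‖
      simpa using h3
    refine squeeze_zero (fun _ => norm_nonneg _) (fun n => ?_) h0
    have := main2 (1 / ((n : ℝ) + 1)) (by positivity)
    rwa [mul_sub, mul_one, norm_sub_rev] at this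
  refine isCompactOperator_of_tendsto htend (Filter.Eventually.of_forall fun n => ?_)
  rw [hKmul _ (by positivity)]
  exact (hcomp.comp_clm _).clm_comp T

theorem symm_of_sa {D : H →ₗ.[ℂ] H} (hD : IsSelfAdjoint D) (x y : D.domain) :
    inner ℂ (D x) (y : H) = inner ℂ (x : H) (D y) := by
  have h := LinearPMap.adjoint_isFormalAdjoint hD.dense_domain
  rw [LinearPMap.isSelfAdjoint_def.1 hD] at h
  exact h x y

/-- `1 + D²` is injective. -/
theorem one_add_sq_inj {D : H →ₗ.[ℂ] H} (hD : IsSelfAdjoint D) (w : H) (h1 : w ∈ D.domain)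
    (h2 : D ⟨w, h1⟩ ∈ D.domain) (h : w + D ⟨D ⟨w, h1⟩, h2⟩ = 0) : w = 0 := by
  have e := congrArg (fun t => RCLike.re (inner ℂ w t)) h
  simp only [inner_add_right, inner_zero_right, map_add, map_zero] at e
  rw [← symm_of_sa hD ⟨w, h1⟩ ⟨D ⟨w, h1⟩, h2⟩, inner_self_eq_norm_sq, inner_self_eq_norm_sq] at e
  have : ‖w‖ ^ 2 = 0 := by nlinarith [sq_nonneg ‖w‖, sq_nonneg ‖D ⟨w, h1⟩‖]
  simpa using this

/-- `R` commutes with `D`. -/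
theorem resolvent_comm {D : H →ₗ.[ℂ] H} (hD : IsSelfAdjoint D) {R : H →L[ℂ] H}
    (hR : IsResolventOfOnePlusSq D R) (x : D.domain) (h : R x ∈ D.domain) :
    R (D x) = D ⟨R x, h⟩ := by
  obtain ⟨h1, h2, h3⟩ := hR x
  obtain ⟨g1, g2, g3⟩ := hR (D x)
  have k3 : D ⟨D ⟨R x, h1⟩, h2⟩ = x - R x := eq_sub_of_add_eq' h3
  have m1 : D ⟨D ⟨R x, h1⟩, h2⟩ ∈ D.domain := by
    rw [k3]; exact D.domain.sub_mem x.2 h1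
  have k4 : D ⟨D ⟨D ⟨R x, h1⟩, h2⟩, m1⟩ = D x - D ⟨R x, h1⟩ := by
    rw [← D.map_sub]
    congr 1
    exact Subtype.ext k3
  have w1 : R (D x) - D ⟨R x, h1⟩ ∈ D.domain := D.domain.sub_mem g1 h2
  have w2 : D ⟨R (D x) - D ⟨R x, h1⟩, w1⟩ = D ⟨R (D x), g1⟩ - D ⟨D ⟨R x, h1⟩, h2⟩ := by
    rw [← D.map_sub]; rfl
  have w3 : D ⟨R (D x) - D ⟨R x, h1⟩, w1⟩ ∈ D.domain := by
    rw [w2]; exact D.domain.sub_mem g2 m1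
  have w4 : D ⟨D ⟨R (D x) - D ⟨R x, h1⟩, w1⟩, w3⟩
      = D ⟨D ⟨R (D x), g1⟩, g2⟩ - D ⟨D ⟨D ⟨R x, h1⟩, h2⟩, m1⟩ := by
    rw [← D.map_sub]
    congr 1
    exact Subtype.ext w2
  refine sub_eq_zero.1 (one_add_sq_inj hD _ w1 w3 ?_)
  rw [w4, k4]
  rw [← sub_eq_zero] at g3
  rw [← g3]
  abel

theorem transform_facts {D : H →ₗ.[ℂ] H} (hD : IsSelfAdjoint D) {R Q F : H →L[ℂ] H}
    (hR : IsResolventOfOnePlusSq D R) (hF : IsBoundedTransform D R Q F) :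
    DenseRange (⇑Q) ∧ Q * F = F * Q ∧ F * F + Q * Q = 1 ∧ ∀ x : D.domain, F x = Q (D x) := by
  obtain ⟨hQ, hQQ, hFQ⟩ := hF
  have hQQ' : ∀ y, Q (Q y) = R y := fun y => congrArg (fun A => A y) hQQ
  have hsa : IsSelfAdjoint Q := hQ.isSelfAdjoint
  have hQ0 : 0 ≤ Q := (ContinuousLinearMap.nonneg_iff_isPositive Q).2 hQ
  have hinj : ∀ x, Q x = 0 → x = 0 := by
    intro x hx
    obtain ⟨h1, h2, h3⟩ := hR x
    have r0 : R x = 0 := by rw [← hQQ', hx, map_zero]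
    have e1 : D ⟨R x, h1⟩ = 0 := by
      rw [← D.map_zero]; congr 1; exact Subtype.ext r0
    have e2 : D ⟨D ⟨R x, h1⟩, h2⟩ = 0 := by
      rw [← D.map_zero]; congr 1; exact Subtype.ext e1
    rw [← h3, e2, r0, add_zero]
  have hdr : DenseRange (⇑Q) := by
    have : (LinearMap.range (Q : H →ₗ[ℂ] H)).topologicalClosure = ⊤ := by
      rw [Submodule.topologicalClosure_eq_top_iff, Submodule.eq_bot_iff]
      intro x hx
      rw [Submodule.mem_orthogonal] at hx
      apply hinj
      have := hx (Q (Q x)) ⟨Q x, rfl⟩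
      rw [hQ.inner_left_eq_inner_right] at this
      exact inner_self_eq_zero.1 this
    rw [← Submodule.dense_iff_topologicalClosure_eq_top] at this
    have e : ((LinearMap.range (Q : H →ₗ[ℂ] H) : Submodule ℂ H) : Set H) = Set.range (⇑Q) := by
      ext; simp
    rw [e] at this
    exact this
  -- `S = F Q` commutes with `R`
  have hS : Commute R (F * Q) := by
    ext y
    obtain ⟨h1, e1⟩ := hFQ (Q y)
    obtain ⟨h2, e2⟩ := hFQ (Q (R y))
    simp only [mul_apply_eq_comp]
    rw [e1, e2]
    have h3 : R (Q (Q y)) ∈ D.domain := (hR _).1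
    rw [resolvent_comm hD hR ⟨Q (Q y), h1⟩ h3]
    congr 1
    apply Subtype.ext
    simp only [hQQ']
  have hQS : Commute Q (F * Q) := by
    have e : Q = CFC.sqrt R := (CFC.sqrt_unique hQQ hQ0).symm
    have := hS.cfc_nnreal NNReal.sqrt
    rw [← CFC.sqrt_eq_cfc, ← e] at this
    exact this
  have ext_dr : ∀ A B : H →L[ℂ] H, (∀ y, A (Q y) = B (Q y)) → A = B := by
    intro A B hAB
    ext x
    exact congrFun (hdr.equalizer A.continuous B.continuous (funext hAB)) x
  have hcomm : Q * F = F * Q := by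
    apply ext_dr
    intro y
    exact congrArg (fun A => A y) hQS.eq
  have hcomm' : ∀ y, Q (F y) = F (Q y) := fun y => congrArg (fun A => A y) hcomm
  have hFsym : ∀ x y, inner ℂ (F x) y = inner ℂ x (F y) := by
    intro x y
    refine hdr.induction_on (p := fun y => inner ℂ (F x) y = inner ℂ x (F y)) y
      (isClosed_eq (by fun_prop) (by fun_prop)) (fun w => ?_)
    obtain ⟨h1, e1⟩ := hFQ x
    obtain ⟨h2, e2⟩ := hFQ w
    rw [← hcomm' w, ← hQ.inner_left_eq_inner_right x, e1, e2]
    exact symm_of_sa hD ⟨Q x, h1⟩ ⟨Q w, h2⟩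
  refine ⟨hdr, hcomm, ?_, ?_⟩
  · ext y
    obtain ⟨h1, h2, h3⟩ := hR y
    obtain ⟨g1, e1⟩ := hFQ (Q y)
    obtain ⟨g2, e2⟩ := hFQ (F y)
    have k1 : D ⟨R y, h1⟩ = Q (F y) := by
      rw [hcomm', e1]; congr 1; exact Subtype.ext (hQQ' y).symm
    have k2 : D ⟨D ⟨R y, h1⟩, h2⟩ = F (F y) := by
      rw [e2]; congr 1; exact Subtype.ext k1
    rw [k2] at h3
    simp only [add_apply, mul_apply_eq_comp, hQQ']
    rw [add_comm]; exact h3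
  · intro x
    refine ext_inner_right ℂ (fun y => ?_)
    obtain ⟨h1, e1⟩ := hFQ y
    rw [hFsym, e1, hQ.inner_left_eq_inner_right]
    exact (symm_of_sa hD x ⟨Q y, h1⟩).symm

theorem sylv_algebra {A : Type*} [Ring A] (F F' Q Q' B : A) (h1 : Q * F = F * Q)
    (h2 : F * F + Q * Q = 1) (h1' : Q' * F' = F' * Q')
    (h2' : F' * F' + Q' * Q' = 1) (hK : F' * Q - Q' * F = Q' * B * Q) :
    (F' - F) * Q + Q' * (F' - F) = Q' * (B - F' * B * F + Q' * B * Q) * Q := by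
  have e : Q' * (B - F' * B * F + Q' * B * Q) * Q
      = (Q' * B * Q) - F' * (Q' * B * Q) * F + Q' * (Q' * B * Q) * Q := by
    have : Q' * (B - F' * B * F + Q' * B * Q) * Q
      = (Q' * B * Q) - (Q' * F') * B * (F * Q) + Q' * (Q' * B * Q) * Q := by noncomm_ring
    rw [this, h1', ← h1]; noncomm_ring
  rw [e, ← hK]
  have a1 : F' * (F' * Q - Q' * F) * F = (F' * F') * (Q * F) - (F' * Q') * (F * F) := by
    noncomm_ring
  have a2 : Q' * (F' * Q - Q' * F) * Q = (Q' * F') * (Q * Q) - (Q' * Q') * (F * Q) := by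
    noncomm_ring
  rw [a1, a2, eq_sub_of_add_eq h2, eq_sub_of_add_eq h2', h1, h1']
  have a3 : Q' * (F' - F) = F' * Q' - Q' * F := by rw [mul_sub, h1']
  rw [a3]
  noncomm_ring

/-- Let `D, D'` be self-adjoint with the same dense domain and bounded difference `B`, and
suppose `(1+D²)⁻¹` and `D(1+D²)⁻¹` are compact.  Then the difference of the bounded
transforms `D(1+D²)^{-1/2} - D'(1+D'²)^{-1/2}` is compact. -/
theorem stmt13 (D D' : H →ₗ.[ℂ] H)
    (hD : IsSelfAdjoint D) (hD' : IsSelfAdjoint D')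
    (hdense : Dense (D.domain : Set H)) (hdomeq : D'.domain = D.domain)
    (B : H →L[ℂ] H)
    (hB : ∀ x : D.domain, D' ⟨(x : H), hdomeq.symm ▸ x.2⟩ = D x + B x)
    (R R' S Q Q' F F' : H →L[ℂ] H)
    (hR : IsResolventOfOnePlusSq D R) (hR' : IsResolventOfOnePlusSq D' R')
    (hS : IsDTimesResolvent D R S)
    (hF : IsBoundedTransform D R Q F) (hF' : IsBoundedTransform D' R' Q' F')
    (hRcompact : IsCompactOperator (⇑R)) (hScompact : IsCompactOperator (⇑S)) :
    IsCompactOperator (⇑(F - F')) := by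
  obtain ⟨hdr, h1, h2, h3⟩ := transform_facts hD hR hF
  obtain ⟨-, h1', h2', h3'⟩ := transform_facts hD' hR' hF'
  have hK : F' * Q - Q' * F = Q' * B * Q := by
    ext y
    obtain ⟨g1, e1⟩ := hF.2.2 y
    have e2 := h3' ⟨Q y, hdomeq.symm ▸ g1⟩
    have e3 := hB ⟨Q y, g1⟩
    simp only at e2 e3
    simp only [sub_apply, mul_apply_eq_comp]
    rw [e2, e3, map_add, e1]
    abel
  have hsyl := sylv_algebra F F' Q Q' B h1 h2 h1' h2' hK
  have hc : IsCompactOperator (⇑(Q * Q)) := by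
    have : Q * Q = R := hF.2.1
    rw [this]; exact hRcompact
  have hT := sylv_compact (F' - F) _ Q Q' hF.1 hF'.1 hsyl hdr hc
  have := hT.neg
  rw [← neg_sub F' F]
  exact this
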